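/- arXiv:1711.10444 — 9 statements merged into one kernel-verified Lean document; each statement's English description precedes it below -/
import Mathlib

section
/- For every η > 0 there exists ε₀ > 0 such that for every ε with 0 < ε < ε₀ one can choose a C² cutoff function φ and parameters b ∈ (0, ε), l > 0, δ > 0 and R₀ > 0 so that the function f_ε is of class C¹ on [0, π] and, at every point x ∈ (0, π) at which f_ε is twice differentiable, it satisfies −f_ε''(x)/f_ε(x) ≥ 1 − η and (1 − f_ε'(x)²)/f_ε(x)² ≥ 1 − η. -/
open Real

/-- The function `f_ε` from the construction: for `0 ≤ x ≤ π/2` it is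
`sin(lx)/l` on `[0,b]`, `(sin(lb)/l)·e^{(1-ε)log(x/b)}` on `[b,ε]`,
`R₀·sin(x + δ·φ_ε(x))` on `[ε, π/2]` (where `φ_ε(x) = φ((x-ε)/(ε^{1/4}-ε))`),
and it is extended symmetrically by `f_ε(x) = f_ε(π - x)` for `π/2 ≤ x ≤ π`. -/
noncomputable def fEps (φ : ℝ → ℝ) (ε b l δ R₀ : ℝ) : ℝ → ℝ := fun x =>
  let y := if x ≤ π / 2 then x else π - x
  if y ≤ b then Real.sin (l * y) / l
  else if y ≤ ε then (Real.sin (l * b) / l) * Real.exp ((1 - ε) * Real.log (y / b))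
  else R₀ * Real.sin (y + δ * φ ((y - ε) / (ε ^ ((1 : ℝ) / 4) - ε)))

open Set Filter Topology

/-! ### Gluing and one-sided derivatives -/

theorem HasDerivAt.ite_le {u v : ℝ → ℝ} {u' v' : ℝ → ℝ} {a y : ℝ}
    (hu : y ≤ a → HasDerivAt u (u' y) y) (hv : a ≤ y → HasDerivAt v (v' y) y)
    (h : u a = v a) (h' : u' a = v' a) :
    HasDerivAt (fun z => if z ≤ a then u z else v z) (if y ≤ a then u' y else v' y) y := by
  rcases lt_trichotomy y a with hy | rfl | hy
  · rw [if_pos hy.le]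
    refine (hu hy.le).congr_of_eventuallyEq ?_
    filter_upwards [Iio_mem_nhds hy] with z hz
    exact if_pos (le_of_lt hz)
  · rw [if_pos le_rfl]
    have hl : HasDerivWithinAt (fun z => if z ≤ y then u z else v z) (u' y) (Iic y) y :=
      (hu le_rfl).hasDerivWithinAt.congr (fun z hz => if_pos hz) (if_pos le_rfl)
    have hr : HasDerivWithinAt (fun z => if z ≤ y then u z else v z) (u' y) (Ici y) y := by
      rw [h']
      refine (hv le_rfl).hasDerivWithinAt.congr (fun z hz => ?_) ((if_pos le_rfl).trans h)
      rcases (mem_Ici.1 hz).eq_or_lt with rfl | hz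
      · exact (if_pos le_rfl).trans h
      · exact if_neg (not_le.2 hz)
    have := hl.union hr
    rwa [Iic_union_Ici, hasDerivWithinAt_univ] at this
  · rw [if_neg (not_le.2 hy)]
    refine (hv hy.le).congr_of_eventuallyEq ?_
    filter_upwards [Ioi_mem_nhds hy] with z hz
    exact if_neg (not_le.2 hz)

theorem ContinuousAt.ite_le {u v : ℝ → ℝ} {a y : ℝ}
    (hu : y ≤ a → ContinuousAt u y) (hv : a ≤ y → ContinuousAt v y) (h : u a = v a) :
    ContinuousAt (fun z => if z ≤ a then u z else v z) y := by
  rcases lt_trichotomy y a with hy | rfl | hy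
  · refine (hu hy.le).congr ?_
    filter_upwards [Iio_mem_nhds hy] with z hz
    exact (if_pos (le_of_lt hz)).symm
  · have hl : ContinuousWithinAt (fun z => if z ≤ y then u z else v z) (Iic y) y :=
      (hu le_rfl).continuousWithinAt.congr (fun z hz => if_pos hz) (if_pos le_rfl)
    have hr : ContinuousWithinAt (fun z => if z ≤ y then u z else v z) (Ici y) y := by
      refine (hv le_rfl).continuousWithinAt.congr (fun z hz => ?_) ((if_pos le_rfl).trans h)
      rcases (mem_Ici.1 hz).eq_or_lt with rfl | hz
      · exact (if_pos le_rfl).trans h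
      · exact if_neg (not_le.2 hz)
    have := hl.union hr
    rwa [Iic_union_Ici, continuousWithinAt_univ] at this
  · refine (hv hy.le).congr ?_
    filter_upwards [Ioi_mem_nhds hy] with z hz
    exact (if_neg (not_le.2 hz)).symm

theorem deriv_eq_of_eqOn_Ioc {g p : ℝ → ℝ} {p' a x : ℝ} (hax : a < x)
    (hg : DifferentiableAt ℝ g x) (hp : HasDerivAt p p' x) (h : EqOn g p (Ioc a x)) :
    deriv g x = p' := by
  have hx : x ∈ Ioc a x := ⟨hax, le_rfl⟩
  have h1 : HasDerivWithinAt p (deriv g x) (Ioc a x) x :=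
    hg.hasDerivAt.hasDerivWithinAt.congr (fun z hz => (h hz).symm) (h hx).symm
  exact (uniqueDiffOn_Ioc a x x hx).eq_deriv _ h1 hp.hasDerivWithinAt

/-! ### The cutoff function -/

theorem exists_bound_of_eq_zero_outside_Icc {g : ℝ → ℝ} (hg : Continuous g)
    (h0 : ∀ x < 0, g x = 0) (h1 : ∀ x > 1, g x = 0) : ∃ M, ∀ x, |g x| ≤ M := by
  obtain ⟨M, hM⟩ := (isCompact_Icc (a := (0 : ℝ)) (b := 1)).exists_bound_of_continuousOn
    hg.continuousOn
  have hM0 : 0 ≤ M := (norm_nonneg _).trans (hM 0 ⟨le_rfl, zero_le_one⟩)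
  refine ⟨M, fun x => ?_⟩
  rcases lt_or_ge x 0 with hx | hx
  · simpa [h0 x hx] using hM0
  rcases lt_or_ge 1 x with hx' | hx'
  · simpa [h1 x hx'] using hM0
  exact hM x ⟨hx, hx'⟩

theorem deriv_eq_zero_of_forall_lt {g : ℝ → ℝ} {a c : ℝ} (h : ∀ x < a, g x = c) :
    ∀ x < a, deriv g x = 0 := fun x hx => by
  have : g =ᶠ[𝓝 x] fun _ => c := by
    filter_upwards [Iio_mem_nhds hx] with z hz using h z hz
  rw [this.deriv_eq, deriv_const]

theorem deriv_eq_zero_of_forall_gt {g : ℝ → ℝ} {a c : ℝ} (h : ∀ x > a, g x = c) :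
    ∀ x > a, deriv g x = 0 := fun x hx => by
  have : g =ᶠ[𝓝 x] fun _ => c := by
    filter_upwards [Ioi_mem_nhds hx] with z hz using h z hz
  rw [this.deriv_eq, deriv_const]

/-- A `C²` cutoff together with explicit first and second derivatives bounded by `M`. -/
theorem exists_cutoff : ∃ (φ φ₁ φ₂ : ℝ → ℝ) (M : ℝ), ContDiff ℝ 2 φ ∧
    (∀ x ≤ (0 : ℝ), φ x = 1) ∧ (∀ x ≥ (1 : ℝ), φ x = 0) ∧ (∀ x, 0 ≤ φ x) ∧ (∀ x, φ x ≤ 1) ∧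
    (∀ x, HasDerivAt φ (φ₁ x) x) ∧ (∀ x, HasDerivAt φ₁ (φ₂ x) x) ∧ φ₁ 0 = 0 ∧
    1 ≤ M ∧ (∀ x, |φ₁ x| ≤ M) ∧ (∀ x, |φ₂ x| ≤ M) := by
  set φ : ℝ → ℝ := fun x => 1 - Real.smoothTransition x with hφ
  have hc : ContDiff ℝ 2 φ := contDiff_const.sub Real.smoothTransition.contDiff
  have h0 : ∀ x ≤ (0 : ℝ), φ x = 1 := fun x hx => by
    simp [hφ, Real.smoothTransition.zero_of_nonpos hx]
  have h1 : ∀ x ≥ (1 : ℝ), φ x = 0 := fun x hx => by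
    simp [hφ, Real.smoothTransition.one_of_one_le hx]
  have hle : ∀ x, φ x ≤ 1 := fun x => by
    simpa [hφ] using Real.smoothTransition.nonneg x
  have hc1 : ContDiff ℝ 1 (deriv φ) := by
    have : ContDiff ℝ (1 + 1) φ := by simpa [one_add_one_eq_two] using hc
    exact (contDiff_succ_iff_deriv.1 this).2.2
  have hd0 := deriv_eq_zero_of_forall_lt fun x (hx : x < 0) => h0 x hx.le
  have hd1 := deriv_eq_zero_of_forall_gt fun x (hx : x > 1) => h1 x hx.le
  obtain ⟨M₁, hM₁⟩ := exists_bound_of_eq_zero_outside_Icc hc1.continuous hd0 hd1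
  obtain ⟨M₂, hM₂⟩ := exists_bound_of_eq_zero_outside_Icc (hc1.continuous_deriv le_rfl)
    (deriv_eq_zero_of_forall_lt hd0) (deriv_eq_zero_of_forall_gt hd1)
  refine ⟨φ, deriv φ, deriv (deriv φ), max 1 (max M₁ M₂), hc, h0, h1, fun x => ?_, hle,
    fun x => (hc.differentiable (by norm_num) x).hasDerivAt,
    fun x => (hc1.differentiable (by norm_num) x).hasDerivAt, ?_, le_max_left _ _,
    fun x => (hM₁ x).trans ((le_max_left _ _).trans (le_max_right _ _)),
    fun x => (hM₂ x).trans ((le_max_right _ _).trans (le_max_right _ _))⟩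
  · simpa [hφ] using Real.smoothTransition.le_one x
  · refine IsLocalMax.deriv_eq_zero (Eventually.of_forall fun x => ?_)
    rw [h0 0 le_rfl]
    exact hle x

/-! ### Matching parameters -/

theorem exists_angle_mul_cos_eq {ε : ℝ} (h0 : 0 < ε) (h1 : ε < 1) :
    ∃ θ, ε ≤ θ ∧ θ < π / 2 ∧ θ * cos θ = (1 - ε) * sin θ := by
  have hpi : ε ≤ π / 2 := by linarith [pi_gt_three]
  have hcont : ContinuousOn (fun θ => θ * cos θ - (1 - ε) * sin θ) (Icc ε (π / 2)) := by fun_prop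
  have h := intermediate_value_Icc' hpi hcont
  have hmem : (0 : ℝ) ∈ Icc (π / 2 * cos (π / 2) - (1 - ε) * sin (π / 2))
      (ε * cos ε - (1 - ε) * sin ε) := by
    constructor
    · simp [h1.le]
    · have := one_sub_sq_div_two_le_cos (x := ε)
      have := sin_le h0.le
      nlinarith
  obtain ⟨θ, hθ, hz⟩ := h hmem
  refine ⟨θ, hθ.1, lt_of_le_of_ne hθ.2 ?_, by simpa [sub_eq_zero] using hz⟩
  rintro rfl
  simp at hz
  linarith

theorem exists_shift {ε : ℝ} (h0 : 0 < ε) (h1 : ε < 1 / 2) :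
    ∃ δ, 0 < δ ∧ δ ≤ 2 * ε ^ 2 ∧ ε * cos (ε + δ) = (1 - ε) * sin (ε + δ) := by
  have hq : 0 < 1 - ε := by linarith
  set ψ := arctan (ε / (1 - ε)) with hψ
  have hψ0 : 0 < ψ := arctan_pos.2 (by positivity)
  have htan : tan ψ = ε / (1 - ε) := tan_arctan _
  have hc : 0 < cos ψ := cos_arctan_pos _
  refine ⟨ψ - ε, ?_, ?_, ?_⟩
  · have hs : sin ε < ε := sin_lt h0
    have hce := one_sub_sq_div_two_le_cos (x := ε)
    have hc0 : 0 < cos ε := by nlinarith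
    have hlt : tan ε < ε / (1 - ε) := by
      rw [tan_eq_sin_div_cos, div_lt_div_iff₀ hc0 hq]
      nlinarith
    have := arctan_strictMono hlt
    rw [arctan_tan (by linarith [pi_gt_three]) (by linarith [pi_gt_three])] at this
    linarith
  · have h := lt_tan hψ0 (arctan_lt_pi_div_two _)
    rw [htan] at h
    have : ε / (1 - ε) ≤ ε + 2 * ε ^ 2 := by
      rw [div_le_iff₀ hq]
      nlinarith [mul_pos h0 h0]
    linarith
  · rw [add_sub_cancel]
    rw [tan_eq_sin_div_cos, div_eq_div_iff hc.ne' hq.ne'] at htan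
    linarith

/-! ### Reflection about `π / 2` -/

section Reflection

variable {f h : ℝ → ℝ} {c : ℝ}

theorem reflect_eq (hf : ∀ x, f x = h (if x ≤ π / 2 then x else π - x)) (x : ℝ) :
    f (π - x) = f x := by
  rw [hf, hf]
  rcases lt_trichotomy x (π / 2) with hx | rfl | hx
  · rw [if_neg (by linarith), if_pos hx.le, sub_sub_cancel]
  · simp only [sub_half]
  · rw [if_pos (by linarith), if_neg (by linarith)]

theorem reflect_eq_of_lt (hf : ∀ x, f x = h (if x ≤ π / 2 then x else π - x))
    (hc : c < π / 2) (hsymm : ∀ y ∈ Ioo c (π - c), h (π - y) = h y) {x : ℝ} (hx : x < π - c) :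
    f x = h x := by
  rw [hf]
  split_ifs with hx'
  · rfl
  · exact hsymm x ⟨hc.trans (not_le.1 hx'), hx⟩

theorem ContDiff.reflect (hf : ∀ x, f x = h (if x ≤ π / 2 then x else π - x))
    (hc : c < π / 2) (hsymm : ∀ y ∈ Ioo c (π - c), h (π - y) = h y) {n : WithTop ℕ∞}
    (hh : ContDiff ℝ n h) : ContDiff ℝ n f := by
  rw [contDiff_iff_contDiffAt]
  intro x
  rcases lt_or_ge x (π - c) with hx | hx
  · refine hh.contDiffAt.congr_of_eventuallyEq ?_
    filter_upwards [Iio_mem_nhds hx] with z hz using reflect_eq_of_lt hf hc hsymm hz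
  · have hcomp : ContDiff ℝ n fun z => h (π - z) := hh.comp (contDiff_const.sub contDiff_id)
    refine hcomp.contDiffAt.congr_of_eventuallyEq ?_
    filter_upwards [Ioi_mem_nhds (show c < x by linarith)] with z hz
    rw [← reflect_eq hf, reflect_eq_of_lt hf hc hsymm (by linarith [mem_Ioi.1 hz])]

/-- A property of `f`, `f'²` and `f''` that holds for `h` on `(0, π / 2]` holds for the
reflection `f` of `h` on `(0, π)`. -/
theorem reflect_forall_of_forall_le (hf : ∀ x, f x = h (if x ≤ π / 2 then x else π - x))
    (hc : c < π / 2) (hsymm : ∀ y ∈ Ioo c (π - c), h (π - y) = h y) {Q : ℝ → ℝ → ℝ → Prop}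
    (hQ : ∀ x, 0 < x → x ≤ π / 2 → DifferentiableAt ℝ (deriv h) x →
      Q (h x) (deriv h x ^ 2) (deriv (deriv h) x)) :
    ∀ x ∈ Ioo (0 : ℝ) π, DifferentiableAt ℝ (deriv f) x →
      Q (f x) (deriv f x ^ 2) (deriv (deriv f) x) := by
  have hleft : ∀ x, 0 < x → x ≤ π / 2 → DifferentiableAt ℝ (deriv f) x →
      Q (f x) (deriv f x ^ 2) (deriv (deriv f) x) := by
    intro x hx0 hx hd
    have heq : f =ᶠ[𝓝 x] h := by
      filter_upwards [Iio_mem_nhds (show x < π - c by linarith)] with z hz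
        using reflect_eq_of_lt hf hc hsymm hz
    rw [heq.eq_of_nhds, heq.deriv_eq, heq.deriv.deriv_eq]
    exact hQ x hx0 hx (hd.congr_of_eventuallyEq heq.deriv.symm)
  have hderiv : deriv f = fun z => -deriv f (π - z) := by
    funext z
    rw [← deriv_comp_const_sub]
    simp only [reflect_eq hf]
  have hderiv₂ : ∀ z, deriv (deriv f) z = deriv (deriv f) (π - z) := by
    intro z
    conv_lhs => rw [hderiv]
    rw [deriv.fun_neg, deriv_comp_const_sub, neg_neg]
  intro x hx hd
  rcases le_or_gt x (π / 2) with hx' | hx'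
  · exact hleft x hx.1 hx' hd
  · have hd' : DifferentiableAt ℝ (deriv f) (π - x) := by
      rw [hderiv]
      refine DifferentiableAt.fun_neg ?_
      refine DifferentiableAt.fun_comp' _ ?_ (by fun_prop)
      rwa [sub_sub_cancel]
    have := hleft (π - x) (by linarith [hx.2]) (by linarith) hd'
    rwa [reflect_eq hf, ← hderiv₂, ← neg_sq, ← congrFun hderiv x] at this

end Reflection

/-! ### The three pieces of the profile -/

theorem hasDerivAt_sin_mul_div {l : ℝ} (hl : l ≠ 0) (y : ℝ) :
    HasDerivAt (fun y => sin (l * y) / l) (cos (l * y)) y := by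
  have := (((hasDerivAt_id y).const_mul l).sin).div_const l
  simpa [hl] using this

theorem hasDerivAt_cos_mul (l y : ℝ) :
    HasDerivAt (fun y => cos (l * y)) (-(l * sin (l * y))) y := by
  have := ((hasDerivAt_id y).const_mul l).cos
  simpa [mul_comm] using this

theorem hasDerivAt_exp_mul_log_div {A q b y : ℝ} (hb : 0 < b) (hy : 0 < y) :
    HasDerivAt (fun y => A * exp (q * log (y / b))) (A * exp (q * log (y / b)) * (q / y)) y := by
  have hlog := ((hasDerivAt_id y).div_const b).log (div_pos hy hb).ne'
  refine (((hlog.const_mul q).exp).const_mul A).congr_deriv ?_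
  simp only [id]
  field_simp

theorem hasDerivAt_deriv_exp_mul_log_div {A q b y : ℝ} (hb : 0 < b) (hy : 0 < y) :
    HasDerivAt (fun y => A * exp (q * log (y / b)) * (q / y))
      (-(q * (1 - q) / y ^ 2) * (A * exp (q * log (y / b)))) y := by
  refine ((hasDerivAt_exp_mul_log_div (A := A) (q := q) hb hy).mul
    ((hasDerivAt_const y q).div (hasDerivAt_id y) hy.ne')).congr_deriv ?_
  simp only [id, Pi.div_apply]
  field_simp
  ring

section OuterPiece

variable {φ φ₁ φ₂ : ℝ → ℝ} {ε w δ R : ℝ}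

theorem hasDerivAt_add_mul_cutoff (h : ∀ x, HasDerivAt φ (φ₁ x) x) (y : ℝ) :
    HasDerivAt (fun y => y + δ * φ ((y - ε) / w)) (1 + δ * φ₁ ((y - ε) / w) / w) y := by
  have hs : HasDerivAt (fun y => (y - ε) / w) (1 / w) y :=
    ((hasDerivAt_id y).sub_const ε).div_const w
  refine ((hasDerivAt_id y).add (((h _).comp y hs).const_mul δ)).congr_deriv ?_
  ring

theorem hasDerivAt_sin_cutoff (h : ∀ x, HasDerivAt φ (φ₁ x) x) (y : ℝ) :
    HasDerivAt (fun y => R * sin (y + δ * φ ((y - ε) / w)))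
      (R * (cos (y + δ * φ ((y - ε) / w)) * (1 + δ * φ₁ ((y - ε) / w) / w))) y :=
  ((hasDerivAt_add_mul_cutoff h y).sin).const_mul R

theorem hasDerivAt_deriv_sin_cutoff (h : ∀ x, HasDerivAt φ (φ₁ x) x)
    (h' : ∀ x, HasDerivAt φ₁ (φ₂ x) x) (y : ℝ) :
    HasDerivAt (fun y => R * (cos (y + δ * φ ((y - ε) / w)) * (1 + δ * φ₁ ((y - ε) / w) / w)))
      (R * (cos (y + δ * φ ((y - ε) / w)) * (δ * φ₂ ((y - ε) / w) / w ^ 2) -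
        sin (y + δ * φ ((y - ε) / w)) * (1 + δ * φ₁ ((y - ε) / w) / w) ^ 2)) y := by
  have hs : HasDerivAt (fun y => (y - ε) / w) (1 / w) y :=
    ((hasDerivAt_id y).sub_const ε).div_const w
  have hY := ((((h' _).comp y hs).const_mul δ).div_const w).const_add 1
  refine ((((hasDerivAt_add_mul_cutoff h y).cos).mul hY).const_mul R).congr_deriv ?_
  simp only [Function.comp_apply]
  ring

end OuterPiece

/-! ### Curvature bounds on the pieces -/

theorem curvature_bounds {η v d s : ℝ} (hv : 0 < v) (h₁ : (1 - η) * v ≤ -s)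
    (h₂ : (1 - η) * v ^ 2 + d ≤ 1) : 1 - η ≤ -s / v ∧ 1 - η ≤ (1 - d) / v ^ 2 := by
  refine ⟨(le_div_iff₀ hv).2 h₁, (le_div_iff₀ (by positivity)).2 ?_⟩
  linarith

theorem curvature_bounds_sin {η l t : ℝ} (hη : 0 < η) (hl : 1 ≤ l) (ht : 0 < sin t) :
    1 - η ≤ -(-(l * sin t)) / (sin t / l) ∧ 1 - η ≤ (1 - cos t ^ 2) / (sin t / l) ^ 2 := by
  have hl0 : 0 < l := by linarith
  have h₁ : -(-(l * sin t)) / (sin t / l) = l ^ 2 := by field_simp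
  have h₂ : (1 - cos t ^ 2) / (sin t / l) ^ 2 = l ^ 2 := by
    rw [← sin_sq]
    field_simp
  rw [h₁, h₂]
  constructor <;> nlinarith

theorem curvature_bounds_pow {η ε x v : ℝ} (hη : 0 < η) (h1 : ε < 1 / 2)
    (hx : 0 < x) (hxε : x ≤ ε) (hv : 0 < v) (hvx : v ≤ x) :
    1 - η ≤ -(-((1 - ε) * (1 - (1 - ε)) / x ^ 2) * v) / v ∧
      1 - η ≤ (1 - (v * ((1 - ε) / x)) ^ 2) / v ^ 2 := by
  have hε : 0 < ε := hx.trans_le hxε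
  have hxx : x ^ 2 ≤ ε ^ 2 := by gcongr
  refine curvature_bounds hv ?_ ?_
  · have : 1 ≤ (1 - ε) * (1 - (1 - ε)) / x ^ 2 := by
      rw [le_div_iff₀ (by positivity)]
      nlinarith
    nlinarith
  · have hs : (v / x) ^ 2 ≤ 1 := by
      have : v / x ≤ 1 := (div_le_one hx).2 hvx
      have h0 : 0 < v / x := by positivity
      nlinarith
    have hv2 : v ^ 2 = (v / x) ^ 2 * x ^ 2 := by field_simp
    have hd : (v * ((1 - ε) / x)) ^ 2 = (v / x) ^ 2 * (1 - ε) ^ 2 := by ring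
    have hle : (v / x) ^ 2 * (x ^ 2 + (1 - ε) ^ 2) ≤ 1 * 1 := by
      refine mul_le_mul hs ?_ (by positivity) zero_le_one
      nlinarith
    have := mul_pos hη (pow_pos hv 2)
    rw [hd]
    nlinarith

theorem curvature_bounds_outer {η ε R Y a c d₁ d₂ : ℝ} (hη : 0 < η) (hε : 0 < ε) (hR : 0 < R)
    (hR' : R ≤ 1 / 4) (hY : ε ≤ Y) (hY' : Y ≤ π / 2) (ha : a ≤ 1) (hc : 0 ≤ c)
    (hac : 2 * a + c ≤ η) (hd₁ : |d₁| ≤ a) (hd₂ : |d₂| ≤ ε * c) :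
    1 - η ≤ -(R * (cos Y * d₂ - sin Y * (1 + d₁) ^ 2)) / (R * sin Y) ∧
      1 - η ≤ (1 - (R * (cos Y * (1 + d₁))) ^ 2) / (R * sin Y) ^ 2 := by
  have hY0 : 0 < Y := hε.trans_le hY
  have hs : 0 < sin Y := sin_pos_of_pos_of_lt_pi hY0 (by linarith [pi_pos])
  have hcos : 0 ≤ cos Y := cos_nonneg_of_neg_pi_div_two_le_of_le (by linarith) hY'
  have hYc : Y * cos Y ≤ sin Y := by
    rcases hY'.eq_or_lt with h | h
    · rw [h]
      simp
    · have hcos' : 0 < cos Y := cos_pos_of_mem_Ioo ⟨by linarith, h⟩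
      have := lt_tan hY0 h
      rw [tan_eq_sin_div_cos, lt_div_iff₀ hcos'] at this
      exact this.le
  obtain ⟨h₁, h₁'⟩ := abs_le.1 hd₁
  have hcd : cos Y * d₂ ≤ c * sin Y := by
    calc cos Y * d₂ ≤ cos Y * (ε * c) := by gcongr; exact (le_abs_self _).trans hd₂
      _ ≤ cos Y * (Y * c) := by gcongr
      _ = c * (Y * cos Y) := by ring
      _ ≤ c * sin Y := by gcongr
  refine curvature_bounds (by positivity) ?_ ?_
  · have hsq : 1 - η + c ≤ (1 + d₁) ^ 2 := by nlinarith [sq_nonneg d₁]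
    have := mul_le_mul_of_nonneg_left hsq hs.le
    nlinarith
  · have hsq : (1 + d₁) ^ 2 ≤ 4 := by nlinarith
    have hcs := sin_sq_add_cos_sq Y
    have hR2 : R ^ 2 ≤ 1 / 16 := by nlinarith
    calc (1 - η) * (R * sin Y) ^ 2 + (R * (cos Y * (1 + d₁))) ^ 2
        ≤ 1 * (R * sin Y) ^ 2 + R ^ 2 * cos Y ^ 2 * (1 + d₁) ^ 2 := by
          rw [mul_pow R (cos Y * _), mul_pow (cos Y), mul_assoc (R ^ 2)]
          gcongr
          linarith
      _ ≤ 1 * (R * sin Y) ^ 2 + R ^ 2 * cos Y ^ 2 * 4 := by gcongr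
      _ ≤ R ^ 2 * 4 := by nlinarith [mul_nonneg (sq_nonneg R) (sq_nonneg (sin Y))]
      _ ≤ 1 := by linarith

/-! ### The unreflected profile -/

/-- The function whose reflection about `π / 2` is `fEps`. -/
noncomputable def profile (φ : ℝ → ℝ) (ε b l δ R w : ℝ) (y : ℝ) : ℝ :=
  if y ≤ b then sin (l * y) / l
  else if y ≤ ε then sin (l * b) / l * exp ((1 - ε) * log (y / b))
  else R * sin (y + δ * φ ((y - ε) / w))

/-- The derivative of `profile`, where `φ₁` is the derivative of `φ`. -/
noncomputable def profileDeriv (φ φ₁ : ℝ → ℝ) (ε b l δ R w : ℝ) (y : ℝ) : ℝ :=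
  if y ≤ b then cos (l * y)
  else if y ≤ ε then sin (l * b) / l * exp ((1 - ε) * log (y / b)) * ((1 - ε) / y)
  else R * (cos (y + δ * φ ((y - ε) / w)) * (1 + δ * φ₁ ((y - ε) / w) / w))

section Profile

variable {φ φ₁ φ₂ : ℝ → ℝ} {ε b l δ R w : ℝ}

theorem hasDerivAt_profile (hb : 0 < b) (hbε : b < ε) (hl : l ≠ 0)
    (hφ0 : φ 0 = 1) (hφ₁0 : φ₁ 0 = 0) (hφ : ∀ x, HasDerivAt φ (φ₁ x) x)
    (hmatch : cos (l * b) = sin (l * b) / l * ((1 - ε) / b))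
    (hval : sin (l * b) / l * exp ((1 - ε) * log (ε / b)) = R * sin (ε + δ))
    (hslope : ε * cos (ε + δ) = (1 - ε) * sin (ε + δ)) (y : ℝ) :
    HasDerivAt (profile φ ε b l δ R w) (profileDeriv φ φ₁ ε b l δ R w y) y := by
  have hε : 0 < ε := hb.trans hbε
  refine HasDerivAt.ite_le (u' := fun y => cos (l * y)) (v' := fun y => if y ≤ ε then
    sin (l * b) / l * exp ((1 - ε) * log (y / b)) * ((1 - ε) / y)
    else R * (cos (y + δ * φ ((y - ε) / w)) * (1 + δ * φ₁ ((y - ε) / w) / w)))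
    (fun _ => hasDerivAt_sin_mul_div hl y) (fun hy => ?_) ?_ ?_
  · refine HasDerivAt.ite_le
      (u' := fun y => sin (l * b) / l * exp ((1 - ε) * log (y / b)) * ((1 - ε) / y))
      (v' := fun y => R * (cos (y + δ * φ ((y - ε) / w)) * (1 + δ * φ₁ ((y - ε) / w) / w)))
      (fun _ => hasDerivAt_exp_mul_log_div hb (hb.trans_le hy))
      (fun _ => hasDerivAt_sin_cutoff hφ y) ?_ ?_
    · simp [hφ0, hval]
    · simp only [hval, sub_self, zero_div, hφ0, hφ₁0, mul_zero, add_zero, mul_one]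
      field_simp
      linear_combination -R * hslope
  · simp [hbε.le, hb.ne']
  · simp [hbε.le, hb.ne', hmatch]

theorem continuous_profileDeriv (hb : 0 < b) (hbε : b < ε)
    (hφ0 : φ 0 = 1) (hφ₁0 : φ₁ 0 = 0) (hφ : ∀ x, HasDerivAt φ (φ₁ x) x)
    (hφ₁ : ∀ x, HasDerivAt φ₁ (φ₂ x) x)
    (hmatch : cos (l * b) = sin (l * b) / l * ((1 - ε) / b))
    (hval : sin (l * b) / l * exp ((1 - ε) * log (ε / b)) = R * sin (ε + δ))
    (hslope : ε * cos (ε + δ) = (1 - ε) * sin (ε + δ)) :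
    Continuous (profileDeriv φ φ₁ ε b l δ R w) := by
  have hε : 0 < ε := hb.trans hbε
  rw [continuous_iff_continuousAt]
  intro y
  refine ContinuousAt.ite_le (fun _ => (hasDerivAt_cos_mul l y).continuousAt) (fun hy => ?_) ?_
  · refine ContinuousAt.ite_le
      (fun _ => (hasDerivAt_deriv_exp_mul_log_div hb (hb.trans_le hy)).continuousAt)
      (fun _ => (hasDerivAt_deriv_sin_cutoff hφ hφ₁ y).continuousAt) ?_
    simp only [hval, sub_self, zero_div, hφ0, hφ₁0, mul_zero, add_zero, mul_one]
    field_simp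
    linear_combination -R * hslope
  · simp [hbε.le, hb.ne', hmatch]

end Profile

/-- Given the angle `θ = l * b` and the phase shift `δ`, the inner radius `b` can be taken so
small that the outer amplitude `R` is at most `1 / 4`. -/
theorem exists_inner_radius {ε θ ψ : ℝ} (h0 : 0 < ε) (hθ : 0 < sin θ) (hθ0 : 0 < θ)
    (hψ : 0 < sin ψ) : ∃ b R, 0 < b ∧ b < ε ∧ 0 < R ∧ R ≤ 1 / 4 ∧
      sin θ / (θ / b) * exp ((1 - ε) * log (ε / b)) = R * sin ψ := by
  set K := sin θ / θ * ε / sin ψ with hK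
  have hK0 : 0 < K := by positivity
  set t := (4 * K) / ε with ht
  have ht0 : 0 < t := by positivity
  have hεt : ε * t = 4 * K := by rw [ht]; field_simp
  refine ⟨ε * exp (-t), K * exp (-(ε * t)), by positivity, ?_, by positivity, ?_, ?_⟩
  · have : exp (-t) < 1 := exp_lt_one_iff.2 (by linarith)
    nlinarith
  · have := add_one_le_exp (ε * t)
    rw [exp_neg, ← div_eq_mul_inv, div_le_iff₀ (exp_pos _)]
    linarith
  · have hlog : log (ε / (ε * exp (-t))) = t := by
      rw [div_mul_eq_div_div, div_self h0.ne', one_div, ← exp_neg, neg_neg, log_exp]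
    have hexp : exp ((1 - ε) * t) = exp t * exp (-(ε * t)) := by
      rw [← exp_add]
      ring_nf
    have hcancel : exp (-t) * exp t = 1 := by rw [← exp_add]; simp
    rw [hlog, hexp, hK]
    calc sin θ / (θ / (ε * exp (-t))) * (exp t * exp (-(ε * t)))
        = sin θ / θ * ε * exp (-(ε * t)) * (exp (-t) * exp t) := by field_simp
      _ = sin θ / θ * ε / sin ψ * exp (-(ε * t)) * sin ψ := by rw [hcancel]; field_simp

theorem profile_curvature_bounds {φ φ₁ φ₂ : ℝ → ℝ} {η ε b l δ R w a c : ℝ} (hη : 0 < η)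
    (hb : 0 < b) (hbε : b < ε) (hε : ε < 1 / 2) (hl : 1 ≤ l) (hlb : l * b < π / 2)
    (hR : 0 < R) (hR' : R ≤ 1 / 4)
    (hφ : ∀ x, HasDerivAt φ (φ₁ x) x) (hφ₁ : ∀ x, HasDerivAt φ₁ (φ₂ x) x)
    (ha : a ≤ 1) (hc : 0 ≤ c) (hac : 2 * a + c ≤ η)
    (h₁ : ∀ x, |δ * φ₁ x / w| ≤ a) (h₂ : ∀ x, |δ * φ₂ x / w ^ 2| ≤ ε * c)
    (hlo : ∀ y, ε < y → ε ≤ y + δ * φ ((y - ε) / w))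
    (hhi : ∀ y, ε < y → y ≤ π / 2 → y + δ * φ ((y - ε) / w) ≤ π / 2)
    (hderiv : deriv (profile φ ε b l δ R w) = profileDeriv φ φ₁ ε b l δ R w) {x : ℝ}
    (hx : 0 < x) (hxπ : x ≤ π / 2) (hd : DifferentiableAt ℝ (deriv (profile φ ε b l δ R w)) x) :
    1 - η ≤ -(deriv (deriv (profile φ ε b l δ R w)) x) / profile φ ε b l δ R w x ∧
      1 - η ≤ (1 - deriv (profile φ ε b l δ R w) x ^ 2) / profile φ ε b l δ R w x ^ 2 := by
  rw [hderiv] at hd ⊢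
  have hl0 : 0 < l := by linarith
  rcases le_or_gt x b with hxb | hbx
  · rw [deriv_eq_of_eqOn_Ioc hx hd (hasDerivAt_cos_mul l x)
      (fun z hz => if_pos (hz.2.trans hxb)), profile, if_pos hxb, profileDeriv, if_pos hxb]
    refine curvature_bounds_sin hη hl (sin_pos_of_pos_of_lt_pi (by positivity) ?_)
    have := mul_le_mul_of_nonneg_left hxb hl0.le
    linarith [pi_pos]
  rcases le_or_gt x ε with hxε | hεx
  · rw [deriv_eq_of_eqOn_Ioc hbx hd (hasDerivAt_deriv_exp_mul_log_div hb hx)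
      (fun z hz => (if_neg (not_le.2 hz.1)).trans (if_pos (hz.2.trans hxε))), profile,
      if_neg (not_le.2 hbx), if_pos hxε, profileDeriv, if_neg (not_le.2 hbx), if_pos hxε]
    have hs : 0 < sin (l * b) :=
      sin_pos_of_pos_of_lt_pi (by positivity) (by linarith [pi_pos])
    refine curvature_bounds_pow hη hε hx hxε (by positivity) ?_
    have hsb : sin (l * b) / l ≤ b := by
      rw [div_le_iff₀ hl0, mul_comm b]
      exact sin_le (by positivity)
    have hexp : exp ((1 - ε) * log (x / b)) ≤ x / b := by
      have hlog : 0 ≤ log (x / b) := log_nonneg ((one_le_div hb).2 hbx.le)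
      calc exp ((1 - ε) * log (x / b)) ≤ exp (log (x / b)) := by
            gcongr
            nlinarith
        _ = x / b := exp_log (by positivity)
    calc sin (l * b) / l * exp ((1 - ε) * log (x / b)) ≤ b * (x / b) := by gcongr
      _ = x := by field_simp
  · have hbx' := not_le.2 hbx
    have hεx' := not_le.2 hεx
    rw [deriv_eq_of_eqOn_Ioc hεx hd (hasDerivAt_deriv_sin_cutoff hφ hφ₁ x)
      (fun z hz => (if_neg (not_le.2 (hbε.trans hz.1))).trans (if_neg (not_le.2 hz.1))), profile,
      if_neg hbx', if_neg hεx', profileDeriv, if_neg hbx', if_neg hεx']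
    exact curvature_bounds_outer hη (hb.trans hbε) hR hR' (hlo x hεx) (hhi x hεx hxπ) ha hc hac
      (h₁ _) (h₂ _)

theorem statement0 :
    ∀ η > (0 : ℝ), ∃ ε₀ > (0 : ℝ), ∀ ε : ℝ, 0 < ε → ε < ε₀ →
      ∃ (φ : ℝ → ℝ) (b l δ R₀ : ℝ),
        ContDiff ℝ 2 φ ∧ (∀ x ≤ (0 : ℝ), φ x = 1) ∧ (∀ x ≥ (1 : ℝ), φ x = 0) ∧
        0 < b ∧ b < ε ∧ 0 < l ∧ 0 < δ ∧ 0 < R₀ ∧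
        ContDiffOn ℝ 1 (fEps φ ε b l δ R₀) (Set.Icc 0 π) ∧
        ∀ x ∈ Set.Ioo (0 : ℝ) π,
          DifferentiableAt ℝ (deriv (fEps φ ε b l δ R₀)) x →
            1 - η ≤ -(deriv (deriv (fEps φ ε b l δ R₀)) x) / fEps φ ε b l δ R₀ x ∧
            1 - η ≤ (1 - (deriv (fEps φ ε b l δ R₀) x) ^ 2) / (fEps φ ε b l δ R₀ x) ^ 2 := by
  intro η hη
  obtain ⟨φ, φ₁, φ₂, M, hφc, hφ0, hφ1, hφnn, hφle, hφ, hφ₁, hφ₁0, hM, hM₁, hM₂⟩ := exists_cutoff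
  have hM0 : 0 < M := by linarith
  set r₀ : ℝ := min (1 / 4) (min (1 / (16 * M)) (η / (16 * M))) with hr₀
  have hr₀0 : 0 < r₀ := by positivity
  refine ⟨r₀ ^ 4, by positivity, fun ε hε hεr => ?_⟩
  set r : ℝ := ε ^ ((1 : ℝ) / 4) with hr
  have hr0 : 0 < r := by positivity
  have hrε : ε = r ^ 4 := by
    rw [hr, ← rpow_natCast, ← rpow_mul hε.le]
    norm_num
  have hrr : r < r₀ := by
    rw [hrε] at hεr
    exact lt_of_pow_lt_pow_left₀ 4 hr₀0.le hεr
  have hr4 : r ≤ 1 / 4 := hrr.le.trans (min_le_left _ _)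
  have hMr : M * r ≤ 1 / 16 := by
    have : r ≤ 1 / (16 * M) := hrr.le.trans ((min_le_right _ _).trans (min_le_left _ _))
    rw [le_div_iff₀ (by positivity)] at this
    linarith
  have hMη : 16 * (M * r) ≤ η := by
    have : r ≤ η / (16 * M) := hrr.le.trans ((min_le_right _ _).trans (min_le_right _ _))
    rw [le_div_iff₀ (by positivity)] at this
    linarith
  have hr3 : r ^ 3 ≤ 1 / 64 := by
    calc r ^ 3 ≤ (1 / 4) ^ 3 := by gcongr
      _ = 1 / 64 := by norm_num
  have hεle : ε ≤ r / 64 := by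
    rw [hrε]
    nlinarith
  have hw : r / 2 ≤ r - ε := by linarith
  have hw0 : 0 < r - ε := by linarith
  obtain ⟨θ, hεθ, hθπ, hθ⟩ := exists_angle_mul_cos_eq hε (by linarith)
  obtain ⟨δ, hδ, hδε, hslope⟩ := exists_shift hε (by linarith)
  have hδ1 : δ ≤ ε := by nlinarith
  have hθ0 : 0 < θ := hε.trans_le hεθ
  have hpi := pi_gt_three
  obtain ⟨b, R, hb, hbε, hR, hR', hamp⟩ := exists_inner_radius hε
    (sin_pos_of_pos_of_lt_pi hθ0 (by linarith)) hθ0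
    (sin_pos_of_pos_of_lt_pi (add_pos hε hδ) (by linarith))
  have hlb : θ / b * b = θ := by field_simp
  have hval : sin (θ / b * b) / (θ / b) * exp ((1 - ε) * log (ε / b)) = R * sin (ε + δ) := by
    rwa [hlb]
  have hl : 1 ≤ θ / b := (one_le_div hb).2 (by linarith)
  have hmatch : cos (θ / b * b) = sin (θ / b * b) / (θ / b) * ((1 - ε) / b) := by
    rw [hlb]
    field_simp
    linarith
  have hδr : δ ≤ 2 * r ^ 8 := by
    calc δ ≤ 2 * ε ^ 2 := hδε
      _ = 2 * r ^ 8 := by rw [hrε]; ring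
  have h₁ : ∀ x, |δ * φ₁ x / (r - ε)| ≤ M * r := fun x => by
    rw [abs_div, abs_mul, abs_of_pos hδ, abs_of_pos hw0, div_le_iff₀ hw0]
    calc δ * |φ₁ x| ≤ (2 * r ^ 8) * M := by gcongr; exact hM₁ x
      _ = M * r * (2 * (r ^ 3 * r ^ 3) * r) := by ring
      _ ≤ M * r * (2 * (1 / 64 * (1 / 64)) * r) := by gcongr
      _ ≤ M * r * (r - ε) := by gcongr; linarith
  have h₂ : ∀ x, |δ * φ₂ x / (r - ε) ^ 2| ≤ ε * (8 * (M * r)) := fun x => by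
    rw [abs_div, abs_mul, abs_of_pos hδ, abs_of_pos (pow_pos hw0 2), div_le_iff₀ (pow_pos hw0 2)]
    calc δ * |φ₂ x| ≤ (2 * r ^ 8) * M := by gcongr; exact hM₂ x
      _ = r ^ 4 * (8 * (M * r)) * (r / 2) ^ 2 * r := by ring
      _ ≤ r ^ 4 * (8 * (M * r)) * (r / 2) ^ 2 * 1 := by gcongr; linarith
      _ = ε * (8 * (M * r)) * (r / 2) ^ 2 := by rw [← hrε, mul_one]
      _ ≤ ε * (8 * (M * r)) * (r - ε) ^ 2 := by gcongr
  have houter : ∀ y, r ≤ y → φ ((y - ε) / (r - ε)) = 0 := fun y hy =>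
    hφ1 _ ((one_le_div hw0).2 (by linarith))
  have hprofile := hasDerivAt_profile (w := r - ε) hb hbε (by positivity) (hφ0 0 le_rfl) hφ₁0 hφ
    hmatch hval hslope
  have hderiv : deriv (profile φ ε b (θ / b) δ R (r - ε)) =
      profileDeriv φ φ₁ ε b (θ / b) δ R (r - ε) := funext fun y => (hprofile y).deriv
  have hC1 : ContDiff ℝ 1 (profile φ ε b (θ / b) δ R (r - ε)) := by
    rw [contDiff_one_iff_deriv, hderiv]
    exact ⟨fun y => (hprofile y).differentiableAt,
      continuous_profileDeriv hb hbε (hφ0 0 le_rfl) hφ₁0 hφ hφ₁ hmatch hval hslope⟩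
  have hsin : ∀ y, r < y → profile φ ε b (θ / b) δ R (r - ε) y = R * sin y := fun y hy => by
    rw [profile, if_neg (by linarith), if_neg (by linarith), houter y hy.le, mul_zero, add_zero]
  have hsymm : ∀ y ∈ Ioo r (π - r), profile φ ε b (θ / b) δ R (r - ε) (π - y) =
      profile φ ε b (θ / b) δ R (r - ε) y := fun y hy => by
    rw [hsin y hy.1, hsin (π - y) (by linarith [hy.2]), sin_pi_sub]
  have hf : ∀ x, fEps φ ε b (θ / b) δ R x =
      profile φ ε b (θ / b) δ R (r - ε) (if x ≤ π / 2 then x else π - x) := fun _ => rfl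
  have hrπ : r < π / 2 := by linarith
  refine ⟨φ, b, θ / b, δ, R, hφc, hφ0, hφ1, hb, hbε, by positivity, hδ, hR,
    (hC1.reflect hf hrπ hsymm).contDiffOn, ?_⟩
  refine reflect_forall_of_forall_le (Q := fun v d s => 1 - η ≤ -s / v ∧ 1 - η ≤ (1 - d) / v ^ 2)
    hf hrπ hsymm fun x hx hxπ hd => ?_
  refine profile_curvature_bounds hη hb hbε (by linarith) hl (by rwa [hlb]) hR hR' hφ hφ₁
    (a := M * r) (c := 8 * (M * r)) (by linarith) (by positivity) (by nlinarith) h₁ h₂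
    (fun y hy => ?_) (fun y hy hyπ => ?_) hderiv hx hxπ hd
  · have := mul_nonneg hδ.le (hφnn ((y - ε) / (r - ε)))
    linarith
  · rcases le_or_gt r y with hry | hry
    · rwa [houter y hry, mul_zero, add_zero]
    · have := mul_le_mul_of_nonneg_left (hφle ((y - ε) / (r - ε))) hδ.le
      linarith
end

section
/- Let tᵢ > 0 and set rᵢ = r·tᵢ, ψᵢ = ψ·tᵢ, Kᵢ = K/tᵢ². Define u(t) = (1/√Kᵢ)·sin(√Kᵢ·(t − tᵢ + ψᵢ)) for t ∈ [tᵢ, tᵢ + 2rᵢ]. Then u(tᵢ) = c·tᵢ; for every t ∈ [tᵢ, tᵢ + 2rᵢ] one has cos Δ ≤ u'(t) ≤ c; and −u''(t)/u(t) = K/tᵢ² for every t ∈ (tᵢ, tᵢ + 2rᵢ). -/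
open Real

/-- The derivative of `t ↦ k⁻¹ sin (k (t - a + b))`. -/
theorem hasDerivAt_inv_mul_sin {k : ℝ} (hk : k ≠ 0) (a b t : ℝ) :
    HasDerivAt (fun t => 1 / k * Real.sin (k * (t - a + b))) (Real.cos (k * (t - a + b))) t := by
  have h : HasDerivAt (fun t => k * (t - a + b)) k t := by
    simpa using (((hasDerivAt_id t).sub_const a).add_const b).const_mul k
  refine (h.sin.const_mul (1 / k)).congr_deriv ?_
  field_simp

/-- The derivative of `t ↦ cos (k (t - a + b))`. -/
theorem hasDerivAt_cos_mul_sub_add (k a b t : ℝ) :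
    HasDerivAt (fun t => Real.cos (k * (t - a + b))) (-Real.sin (k * (t - a + b)) * k) t := by
  have h : HasDerivAt (fun t => k * (t - a + b)) k t := by
    simpa using (((hasDerivAt_id t).sub_const a).add_const b).const_mul k
  exact h.cos

theorem statement3 (c K ψ rc r Δ ti Ki ri ψi : ℝ) (u : ℝ → ℝ)
    (hc0 : 0 < c) (hc1 : c < 1 / 3)
    (hK : K = (1 - c ^ 2) / c ^ 2)
    (hψ0 : 0 < ψ)
    (hψ : Real.sqrt K * ψ = Real.arcsin (Real.sqrt (1 - c ^ 2)))
    (hrc : rc = π / (4 * Real.sqrt K) - ψ / 2)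
    (hr0 : 0 < r) (hr1 : r ≤ rc)
    (hΔ : Δ = Real.sqrt K * (2 * r + ψ))
    (hti : 0 < ti)
    (hKi : Ki = K / ti ^ 2) (hri : ri = r * ti) (hψi : ψi = ψ * ti)
    (hu : ∀ t : ℝ, u t = (1 / Real.sqrt Ki) * Real.sin (Real.sqrt Ki * (t - ti + ψi))) :
    u ti = c * ti ∧
      (∀ t ∈ Set.Icc ti (ti + 2 * ri), Real.cos Δ ≤ deriv u t ∧ deriv u t ≤ c) ∧
      (∀ t ∈ Set.Ioo ti (ti + 2 * ri), -(deriv (deriv u) t) / u t = K / ti ^ 2) := by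
  have hc2 : 0 < 1 - c ^ 2 := by nlinarith
  have hs : 0 < √(1 - c ^ 2) := Real.sqrt_pos.2 hc2
  have hsK : √K = √(1 - c ^ 2) / c := by
    rw [hK, Real.sqrt_div hc2.le, Real.sqrt_sq hc0.le]
  have hK0 : 0 < √K := hsK ▸ div_pos hs hc0
  have hsKi : √Ki = √K / ti := by
    rw [hKi, Real.sqrt_div' _ (sq_nonneg ti), Real.sqrt_sq hti.le]
  have hKi0 : 0 < √Ki := hsKi ▸ div_pos hK0 hti
  have hsin : Real.sin (√K * ψ) = √(1 - c ^ 2) := by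
    rw [hψ, Real.sin_arcsin (by linarith) (Real.sqrt_le_one.2 (by nlinarith))]
  have hcos : Real.cos (√K * ψ) = c := by
    rw [hψ, Real.cos_arcsin, Real.sq_sqrt hc2.le, sub_sub_cancel, Real.sqrt_sq hc0.le]
  have hψ_arg : √Ki * ψi = √K * ψ := by
    rw [hsKi, hψi]
    field_simp
  have hΔ_arg : √Ki * (2 * ri + ψi) = Δ := by
    rw [hsKi, hri, hψi, hΔ]
    field_simp
  have hΔ_le : Δ ≤ π / 2 := by
    have h : √K * (2 * r + ψ) ≤ √K * (2 * rc + ψ) := by gcongr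
    rw [hΔ]
    refine h.trans_eq ?_
    rw [hrc]
    field_simp
    ring
  have hψ_pos : 0 < √K * ψ := mul_pos hK0 hψ0
  have hu_fun : u = fun t => 1 / √Ki * Real.sin (√Ki * (t - ti + ψi)) := funext hu
  have hderiv : deriv u = fun t => Real.cos (√Ki * (t - ti + ψi)) := by
    rw [hu_fun]
    exact funext fun t => (hasDerivAt_inv_mul_sin hKi0.ne' ti ψi t).deriv
  have harg : ∀ t ∈ Set.Icc ti (ti + 2 * ri),
      √K * ψ ≤ √Ki * (t - ti + ψi) ∧ √Ki * (t - ti + ψi) ≤ Δ := by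
    rintro t ⟨h₁, h₂⟩
    rw [← hψ_arg, ← hΔ_arg]
    constructor <;> gcongr <;> linarith
  refine ⟨?_, fun t ht => ?_, fun t ht => ?_⟩
  · rw [hu, sub_self, zero_add, hψ_arg, hsin, hsKi, hsK]
    field_simp
  · obtain ⟨h₁, h₂⟩ := harg t ht
    rw [hderiv]
    refine ⟨Real.cos_le_cos_of_nonneg_of_le_pi (by linarith) (by linarith [Real.pi_pos]) h₂, ?_⟩
    exact (Real.cos_le_cos_of_nonneg_of_le_pi hψ_pos.le (by linarith [Real.pi_pos]) h₁).trans_eq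
      hcos
  · obtain ⟨h₁, h₂⟩ := harg t (Set.Ioo_subset_Icc_self ht)
    have hpos : 0 < Real.sin (√Ki * (t - ti + ψi)) :=
      Real.sin_pos_of_pos_of_lt_pi (by linarith) (by linarith [Real.pi_pos])
    have hKi_sq : √Ki * √Ki = Ki := Real.mul_self_sqrt (Real.sqrt_pos.1 hKi0).le
    rw [hderiv, (hasDerivAt_cos_mul_sub_add _ _ _ _).deriv, hu, ← hKi, div_eq_iff (by positivity)]
    nth_rewrite 3 [← hKi_sq]
    field_simp
end

section
/- For every c with 0 < c < 1/3 and every r with 0 < r ≤ r(c), one has sin(Δ)/√K < c·(1 + 2r). -/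
open Real

theorem statement4 (c K ψ rc : ℝ)
    (hc0 : 0 < c) (hc1 : c < 1 / 3)
    (hK : K = (1 - c ^ 2) / c ^ 2)
    (hψ0 : 0 < ψ)
    (hψ : Real.sqrt K * ψ = Real.arcsin (Real.sqrt (1 - c ^ 2)))
    (hrc : rc = π / (4 * Real.sqrt K) - ψ / 2) :
    ∀ r : ℝ, 0 < r → r ≤ rc →
      Real.sin (Real.sqrt K * (2 * r + ψ)) / Real.sqrt K < c * (1 + 2 * r) := by
  intro r hr _
  have hs2 : 0 < 1 - c ^ 2 := by nlinarith
  have hsqrtK : √K = √(1 - c ^ 2) / c := by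
    rw [hK, Real.sqrt_div hs2.le, Real.sqrt_sq hc0.le]
  have hs : 0 < √(1 - c ^ 2) := Real.sqrt_pos.2 hs2
  have hk : 0 < √K := hsqrtK ▸ div_pos hs hc0
  have hsk : √(1 - c ^ 2) = c * √K := by rw [hsqrtK]; field_simp
  have hsin : sin (√K * ψ) = c * √K := by
    rw [hψ, Real.sin_arcsin (by linarith) (Real.sqrt_le_one.2 (by nlinarith)), hsk]
  have hcos : cos (√K * ψ) = c := by
    rw [hψ, Real.cos_arcsin, Real.sq_sqrt hs2.le, sub_sub_cancel, Real.sqrt_sq hc0.le]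
  rw [div_lt_iff₀ hk, mul_add, Real.sin_add, hsin, hcos]
  have hx : sin (√K * (2 * r)) < √K * (2 * r) := Real.sin_lt (by positivity)
  have h_sin := mul_lt_mul_of_pos_right hx hc0
  have h_cos := mul_le_mul_of_nonneg_right (Real.cos_le_one (√K * (2 * r)))
    (mul_pos hc0 hk).le
  linarith
end

section
/- Let α > 1 + 2r and set L = log(α/(1 + 2r)). If cos Δ ≥ (c + 1)/L, then sin(Δ)/√K + (α − 1 − 2r)·cos Δ + ((c + 1)/(2L))·(α·L − α + 1 + 2r) > c·α. -/
open Real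

theorem statement5 (c K ψ rc r Δ α L : ℝ)
    (hc0 : 0 < c) (hc1 : c < 1 / 3)
    (hK : K = (1 - c ^ 2) / c ^ 2)
    (hψ0 : 0 < ψ)
    (hψ : Real.sqrt K * ψ = Real.arcsin (Real.sqrt (1 - c ^ 2)))
    (hrc : rc = π / (4 * Real.sqrt K) - ψ / 2)
    (hr0 : 0 < r) (hr1 : r < rc)
    (hΔ : Δ = Real.sqrt K * (2 * r + ψ))
    (hα : α > 1 + 2 * r)
    (hL : L = Real.log (α / (1 + 2 * r)))
    (hcos : Real.cos Δ ≥ (c + 1) / L) :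
    Real.sin Δ / Real.sqrt K + (α - 1 - 2 * r) * Real.cos Δ
      + ((c + 1) / (2 * L)) * (α * L - α + 1 + 2 * r) > c * α := by
  have hc2 : 0 < c ^ 2 := by positivity
  have hKpos : 0 < K := by
    rw [hK]
    exact div_pos (by nlinarith) hc2
  have hsK : 0 < √K := Real.sqrt_pos.mpr hKpos
  have hΔ0 : 0 < Δ := by rw [hΔ]; positivity
  have hΔ1 : Δ < π / 2 := by
    have h : 2 * r + ψ < π / (2 * √K) := by
      have h2 : π / (2 * √K) = 2 * (π / (4 * √K)) := by field_simp; norm_num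
      linarith
    calc Δ = √K * (2 * r + ψ) := hΔ
      _ < √K * (π / (2 * √K)) := mul_lt_mul_of_pos_left h hsK
      _ = π / 2 := by field_simp
  have hsin : 0 < Real.sin Δ / √K :=
    div_pos (Real.sin_pos_of_pos_of_lt_pi hΔ0 (by linarith [Real.pi_pos])) hsK
  have hs : 0 < 1 + 2 * r := by linarith
  have hL0 : 0 < L := by
    rw [hL]
    exact Real.log_pos ((one_lt_div hs).mpr hα)
  have hm : 0 < (c + 1) / L := by positivity
  have hx : 0 < α - 1 - 2 * r := by linarith
  have hmul : (α - 1 - 2 * r) * ((c + 1) / L) ≤ (α - 1 - 2 * r) * Real.cos Δ :=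
    mul_le_mul_of_nonneg_left hcos hx.le
  have hsplit : (c + 1) / (2 * L) * (α * L - α + 1 + 2 * r)
      = α * (c + 1) / 2 - (α - 1 - 2 * r) * ((c + 1) / L) / 2 := by
    field_simp
    ring
  have hprod : 0 < (α - 1 - 2 * r) * ((c + 1) / L) := mul_pos hx hm
  have hαc : 0 < α * (1 - c) := mul_pos (by linarith) (by linarith)
  rw [hsplit]
  linarith
end

section
/- Let α > 1 + 2r, L = log(α/(1 + 2r)), and define v(t) = sin(Δ)/√K + (t − 1 − 2r)·cos Δ + ((c + 1)/(2L))·(t·log(t/(1 + 2r)) − t + 1 + 2r) for t ∈ [1 + 2r, α]. If cos Δ ≥ (c + 1)/L, then for every t ∈ [1 + 2r, α] one has cos Δ ≤ v'(t) ≤ (1 + 3c)/2 < 1. -/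
open Real

/-- The function `t ↦ t * log (t / a) - t` has derivative `log (t / a)`. -/
theorem hasDerivAt_mul_log_div_sub_self {a t : ℝ} (ha : a ≠ 0) (ht : t ≠ 0) :
    HasDerivAt (fun s : ℝ => s * Real.log (s / a) - s) (Real.log (t / a)) t := by
  have h := ((hasDerivAt_id t).mul
    (((hasDerivAt_id t).div_const a).log (div_ne_zero ht ha))).sub (hasDerivAt_id t)
  refine h.congr_deriv ?_
  simp only [id]
  field_simp
  ring

/-- The angle `arcsin √(1 - c²)` has cosine `c`. -/
theorem cos_arcsin_sqrt_one_sub_sq {c : ℝ} (hc0 : 0 ≤ c) (hc1 : c ≤ 1) :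
    Real.cos (Real.arcsin (Real.sqrt (1 - c ^ 2))) = c := by
  rw [Real.cos_arcsin, Real.sq_sqrt (by nlinarith), sub_sub_cancel, Real.sqrt_sq hc0]

theorem statement6 (c K ψ rc r Δ α L : ℝ) (v : ℝ → ℝ)
    (hc0 : 0 < c) (hc1 : c < 1 / 3)
    (hK : K = (1 - c ^ 2) / c ^ 2)
    (hψ0 : 0 < ψ)
    (hψ : Real.sqrt K * ψ = Real.arcsin (Real.sqrt (1 - c ^ 2)))
    (hrc : rc = π / (4 * Real.sqrt K) - ψ / 2)
    (hr0 : 0 < r) (hr1 : r < rc)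
    (hΔ : Δ = Real.sqrt K * (2 * r + ψ))
    (hα : α > 1 + 2 * r)
    (hL : L = Real.log (α / (1 + 2 * r)))
    (hv : ∀ t : ℝ, v t = Real.sin Δ / Real.sqrt K + (t - 1 - 2 * r) * Real.cos Δ
      + ((c + 1) / (2 * L)) * (t * Real.log (t / (1 + 2 * r)) - t + 1 + 2 * r))
    (hcos : Real.cos Δ ≥ (c + 1) / L) :
    ∀ t ∈ Set.Icc (1 + 2 * r) α,
      Real.cos Δ ≤ deriv v t ∧ deriv v t ≤ (1 + 3 * c) / 2 ∧ (1 + 3 * c) / 2 < 1 := by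
  intro t ⟨ht₁, ht₂⟩
  have ha : 0 < 1 + 2 * r := by linarith
  have ht : 0 < t := by linarith
  have hLpos : 0 < L := hL ▸ Real.log_pos ((one_lt_div ha).2 hα)
  have hKpos : 0 < Real.sqrt K := by
    rw [hK]
    exact Real.sqrt_pos.2 (div_pos (by nlinarith) (by positivity))
  have hΔ_le : Δ ≤ π := by
    have hlt : 2 * r + ψ < π / (2 * Real.sqrt K) := by
      have : π / (2 * Real.sqrt K) = 2 * (π / (4 * Real.sqrt K)) := by
        field_simp
        norm_num
      linarith
    rw [lt_div_iff₀ (by positivity)] at hlt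
    nlinarith [Real.pi_pos]
  have hcosΔ : Real.cos Δ ≤ c := by
    rw [← cos_arcsin_sqrt_one_sub_sq hc0.le (by linarith : c ≤ 1), ← hψ]
    exact Real.cos_le_cos_of_nonneg_of_le_pi (by positivity) hΔ_le (by rw [hΔ]; nlinarith)
  have hderiv : deriv v t =
      Real.cos Δ + (c + 1) / (2 * L) * Real.log (t / (1 + 2 * r)) := by
    have hlin := ((((hasDerivAt_id t).sub_const 1).sub_const (2 * r)).mul_const
      (Real.cos Δ)).const_add (Real.sin Δ / Real.sqrt K)
    have hlog := (((hasDerivAt_mul_log_div_sub_self ha.ne' ht.ne').add_const 1).add_const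
      (2 * r)).const_mul ((c + 1) / (2 * L))
    rw [funext hv]
    exact ((hlin.add hlog).congr_deriv (by rw [one_mul])).deriv
  have hlog_nonneg : 0 ≤ Real.log (t / (1 + 2 * r)) := Real.log_nonneg ((one_le_div ha).2 ht₁)
  have hlog_le : Real.log (t / (1 + 2 * r)) ≤ L := by
    rw [hL]
    exact Real.log_le_log (by positivity) (by gcongr)
  have hcoeff : 0 ≤ (c + 1) / (2 * L) := by positivity
  have hmul_le : (c + 1) / (2 * L) * Real.log (t / (1 + 2 * r)) ≤ (c + 1) / 2 :=
    calc (c + 1) / (2 * L) * Real.log (t / (1 + 2 * r))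
        ≤ (c + 1) / (2 * L) * L := by gcongr
      _ = (c + 1) / 2 := by field_simp
  rw [hderiv]
  exact ⟨le_add_of_nonneg_right (mul_nonneg hcoeff hlog_nonneg), by linarith, by linarith⟩
end

section
/- Fix γ with 0 < γ < 1/4. There exists α₁ = α₁(c, r, γ) > 1 + 2r such that for every α ≥ α₁, writing L = log(α/(1 + 2r)) and assuming cos Δ ≥ (c + 1)/L, the function v(t) = sin(Δ)/√K + (t − 1 − 2r)·cos Δ + ((c + 1)/(2L))·(t·log(t/(1 + 2r)) − t + 1 + 2r) satisfies −3·v''(t)/v(t) + γ·(1 − 2γ)/t² > 0 for every t ∈ [1 + 2r, α]. -/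
open Real

/-- The second derivative of an affine function plus a multiple of `t * log (t / b) - t + b`. -/
theorem deriv_deriv_affine_add_mul_log {v : ℝ → ℝ} {p q A b : ℝ} (hb : 0 < b)
    (hv : ∀ t, v t = p + (t - b) * q + A * (t * Real.log (t / b) - t + b))
    {t : ℝ} (ht : 0 < t) : deriv (deriv v) t = A / t := by
  have hlog : ∀ s : ℝ, 0 < s → HasDerivAt (fun x => Real.log (x / b)) (1 / s) s := by
    intro s hs
    have h := ((hasDerivAt_id' s).div_const b).log (div_pos hs hb).ne'
    convert h using 1
    field_simp
  have hfirst : ∀ s : ℝ, 0 < s → HasDerivAt v (q + A * Real.log (s / b)) s := by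
    intro s hs
    rw [funext hv]
    have h := ((((hasDerivAt_id' s).sub_const b).mul_const q).const_add p).add
      (((((hasDerivAt_id' s).mul (hlog s hs)).sub (hasDerivAt_id' s)).add_const b).const_mul A)
    refine h.congr_deriv ?_
    field_simp
    ring
  have heq : deriv v =ᶠ[nhds t] fun s => q + A * Real.log (s / b) := by
    filter_upwards [lt_mem_nhds ht] with s hs using (hfirst s hs).deriv
  rw [heq.deriv_eq, (((hlog t ht).const_mul A).const_add q).deriv, mul_one_div]

theorem mul_log_div_sub_add_nonneg {b t : ℝ} (hb : 0 < b) (ht : 0 < t) :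
    0 ≤ t * Real.log (t / b) - t + b := by
  have h := mul_le_mul_of_nonneg_left (Real.one_sub_inv_le_log_of_pos (div_pos ht hb)) ht.le
  have h' : t * (1 - (t / b)⁻¹) = t - b := by field_simp
  linarith

theorem statement7 (c K ψ rc r Δ γ : ℝ)
    (hc0 : 0 < c) (hc1 : c < 1 / 3)
    (hK : K = (1 - c ^ 2) / c ^ 2)
    (hψ0 : 0 < ψ)
    (hψ : Real.sqrt K * ψ = Real.arcsin (Real.sqrt (1 - c ^ 2)))
    (hrc : rc = π / (4 * Real.sqrt K) - ψ / 2)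
    (hr0 : 0 < r) (hr1 : r < rc)
    (hΔ : Δ = Real.sqrt K * (2 * r + ψ))
    (hγ0 : 0 < γ) (hγ1 : γ < 1 / 4) :
    ∃ α₁ : ℝ, α₁ > 1 + 2 * r ∧
      ∀ α : ℝ, α ≥ α₁ →
        Real.cos Δ ≥ (c + 1) / Real.log (α / (1 + 2 * r)) →
        ∀ v : ℝ → ℝ,
          (∀ t : ℝ, v t = Real.sin Δ / Real.sqrt K + (t - 1 - 2 * r) * Real.cos Δ
            + ((c + 1) / (2 * Real.log (α / (1 + 2 * r))))
              * (t * Real.log (t / (1 + 2 * r)) - t + 1 + 2 * r)) →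
          ∀ t ∈ Set.Icc (1 + 2 * r) α,
            -3 * (deriv (deriv v) t) / v t + γ * (1 - 2 * γ) / t ^ 2 > 0 := by
  have hK0 : 0 < K := by
    rw [hK]
    exact div_pos (by nlinarith) (by positivity)
  have hs : 0 < √K := Real.sqrt_pos.mpr hK0
  have hΔ0 : 0 < Δ := by rw [hΔ]; positivity
  have hΔ1 : Δ < π / 2 := by
    have h : √K * (2 * rc + ψ) = π / 2 := by
      rw [hrc]
      field_simp
      ring
    rw [hΔ, ← h]
    gcongr
  have hcos : 0 < Real.cos Δ := Real.cos_pos_of_mem_Ioo ⟨by linarith, hΔ1⟩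
  have ha : 0 < Real.sin Δ / √K :=
    div_pos (Real.sin_pos_of_pos_of_lt_pi hΔ0 (by linarith)) hs
  obtain ⟨b, hb⟩ : ∃ b, b = 1 + 2 * r := ⟨_, rfl⟩
  have hb0 : 0 < b := by linarith
  rw [← hb]
  obtain ⟨a, ha'⟩ : ∃ a, a = Real.sin Δ / √K := ⟨_, rfl⟩
  rw [← ha'] at ha ⊢
  obtain ⟨ε, hε0, hεa, hεcos⟩ : ∃ ε > 0, ε * b ≤ a ∧ ε ≤ Real.cos Δ :=
    ⟨min (a / b) (Real.cos Δ), lt_min (div_pos ha hb0) hcos,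
      (le_div_iff₀ hb0).mp (min_le_left _ _), min_le_right _ _⟩
  have hg : 0 < γ * (1 - 2 * γ) := mul_pos hγ0 (by linarith)
  generalize γ * (1 - 2 * γ) = g at hg ⊢
  have hM : 0 < 2 / (g * ε) := by positivity
  refine ⟨b * Real.exp (2 / (g * ε)),
    lt_mul_of_one_lt_right hb0 (Real.one_lt_exp_iff.mpr hM), ?_⟩
  intro α hα _ v hv t ht
  have ht0 : 0 < t := hb0.trans_le ht.1
  have hL : 2 / (g * ε) ≤ Real.log (α / b) := by
    rw [Real.le_log_iff_exp_le (div_pos (ht0.trans_le ht.2) hb0), le_div_iff₀ hb0]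
    linarith
  generalize Real.log (α / b) = L at hL hv
  have hL0 : 0 < L := hM.trans_le hL
  have hv' : ∀ t, v t = a + (t - b) * Real.cos Δ
      + (c + 1) / (2 * L) * (t * Real.log (t / b) - t + b) := by
    intro t
    rw [hv, hb]
    ring
  rw [deriv_deriv_affine_add_mul_log hb0 hv' ht0]
  have hA0 : 0 < (c + 1) / (2 * L) := by positivity
  have hA : 3 * ((c + 1) / (2 * L)) < g * ε := by
    rw [div_le_iff₀ (by positivity)] at hL
    rw [← mul_div_assoc, div_lt_iff₀ (by positivity)]
    nlinarith
  have hvt : ε * t ≤ v t := by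
    have h := mul_nonneg hA0.le (mul_log_div_sub_add_nonneg hb0 ht0)
    have h' := mul_le_mul_of_nonneg_left hεcos (sub_nonneg.mpr ht.1)
    rw [hv']
    linarith
  generalize (c + 1) / (2 * L) = A at hA hA0
  have hv0 : 0 < v t := (mul_pos hε0 ht0).trans_le hvt
  have hnum : 0 < g * v t - 3 * A * t := by
    have h := mul_lt_mul_of_pos_right hA ht0
    have h' := mul_le_mul_of_nonneg_left hvt hg.le
    linarith
  have heq : -3 * (A / t) / v t + g / t ^ 2 = (g * v t - 3 * A * t) / (t ^ 2 * v t) := by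
    field_simp
    ring
  rw [heq]
  positivity
end

section
/- Let tᵢ > 0, rᵢ = r·tᵢ, t_{i+1} = α·tᵢ, r_{i+1} = r·t_{i+1}. Then the integral of φ over the interval [tᵢ + rᵢ/6, t_{i+1} + r_{i+1}/6] equals γ·log α. Equivalently, the positive solution g of g'/g = φ with initial condition g(tᵢ + rᵢ/6) = (tᵢ + rᵢ/6)^γ satisfies g(t_{i+1} + r_{i+1}/6) = (t_{i+1} + r_{i+1}/6)^γ. -/
open Real

open MeasureTheory in
theorem intervalIntegrable_and_integral_eq_of_eqOn_Icc {f φ : ℝ → ℝ} {a b : ℝ} (hab : a ≤ b)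
    (hf : ContinuousOn f (Set.Icc a b)) (h : ∀ t ∈ Set.Icc a b, φ t = f t) :
    IntervalIntegrable φ volume a b ∧ ∫ t in a..b, φ t = ∫ t in a..b, f t := by
  have hφ : ContinuousOn φ (Set.Icc a b) := hf.congr h
  refine ⟨hφ.intervalIntegrable_of_Icc hab, intervalIntegral.integral_congr fun t ht => h t ?_⟩
  rwa [Set.uIcc_of_le hab] at ht

theorem integral_const_mul_sub_left (c a b : ℝ) :
    ∫ t in a..b, c * (t - a) = c * (b - a) ^ 2 / 2 := by
  rw [intervalIntegral.integral_const_mul,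
    intervalIntegral.integral_comp_sub_right (fun t => t) a, integral_id]
  ring

theorem integral_const_mul_sub_right (c a b : ℝ) :
    ∫ t in a..b, c * (b - t) = c * (b - a) ^ 2 / 2 := by
  rw [intervalIntegral.integral_const_mul,
    intervalIntegral.integral_comp_sub_left (fun t => t) b, integral_id]
  ring

/-- The logarithm of a positive solution of `g' = φ g` grows by `∫ φ` across an interval. -/
theorem log_sub_log_eq_integral_of_hasDerivAt {g φ : ℝ → ℝ} {a b : ℝ} (hab : a ≤ b)
    (hφ : IntervalIntegrable φ MeasureTheory.volume a b) (hg : ∀ t, 0 < g t)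
    (hderiv : ∀ t ∈ Set.Icc a b, HasDerivAt g (φ t * g t) t) :
    ∫ t in a..b, φ t = Real.log (g b) - Real.log (g a) := by
  refine intervalIntegral.integral_eq_sub_of_hasDerivAt (f := fun t => Real.log (g t))
    (fun t ht => ?_) hφ
  rw [Set.uIcc_of_le hab] at ht
  have h := (hderiv t ht).log (hg t).ne'
  rwa [mul_div_cancel_right₀ _ (hg t).ne'] at h

theorem statement8 (r γ α β ti : ℝ) (φ : ℝ → ℝ)
    (hr : 0 < r) (hγ : 0 < γ) (hα : α > 1 + 2 * r)
    (hβ : β = Real.log α /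
      (Real.log α - Real.log (1 + 2 * r) + r * (1 + r) / (6 * (1 + 2 * r))))
    (hti : 0 < ti)
    (hφ1 : ∀ t ∈ Set.Icc (ti + r * ti / 6) (ti + 11 * (r * ti) / 6), φ t = 0)
    (hφ2 : ∀ t ∈ Set.Icc (ti + 11 * (r * ti) / 6) (ti + 2 * (r * ti)),
      φ t = (6 * γ * β / ((1 + 2 * r) * r * ti ^ 2)) * (t - (ti + 11 * (r * ti) / 6)))
    (hφ3 : ∀ t ∈ Set.Icc (ti + 2 * (r * ti)) (α * ti), φ t = γ * β / t)
    (hφ4 : ∀ t ∈ Set.Icc (α * ti) (α * ti + r * (α * ti) / 6),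
      φ t = (6 * γ * β / (α ^ 2 * r * ti ^ 2)) * ((α * ti + r * (α * ti) / 6) - t)) :
    (∫ t in (ti + r * ti / 6)..(α * ti + r * (α * ti) / 6), φ t) = γ * Real.log α ∧
      ∀ g : ℝ → ℝ, (∀ t : ℝ, 0 < g t) →
        (∀ t ∈ Set.Icc (ti + r * ti / 6) (α * ti + r * (α * ti) / 6),
          HasDerivAt g (φ t * g t) t) →
        g (ti + r * ti / 6) = (ti + r * ti / 6) ^ γ →
        g (α * ti + r * (α * ti) / 6) = (α * ti + r * (α * ti) / 6) ^ γ := by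
  have hα0 : 0 < α := by linarith
  have hr2 : 0 < 1 + 2 * r := by linarith
  have hrt : 0 < r * ti := mul_pos hr hti
  have hαt : 0 < α * ti := mul_pos hα0 hti
  have hrαt : 0 < r * (α * ti) := mul_pos hr hαt
  have hle : ti + 2 * (r * ti) ≤ α * ti := by nlinarith
  have hpos : 0 < ti + 2 * (r * ti) := by linarith
  obtain ⟨i1, e1⟩ := intervalIntegrable_and_integral_eq_of_eqOn_Icc (f := fun _ => 0)
    (by linarith) continuousOn_const hφ1
  obtain ⟨i2, e2⟩ := intervalIntegrable_and_integral_eq_of_eqOn_Icc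
    (by linarith) (by fun_prop) hφ2
  obtain ⟨i3, e3⟩ := intervalIntegrable_and_integral_eq_of_eqOn_Icc (f := fun t => γ * β / t) hle
    (continuousOn_const.div continuousOn_id fun t ht => (hpos.trans_le ht.1).ne') hφ3
  obtain ⟨i4, e4⟩ := intervalIntegrable_and_integral_eq_of_eqOn_Icc
    (by linarith) (by fun_prop) hφ4
  have hlog : Real.log (1 + 2 * r) < Real.log α := Real.log_lt_log hr2 hα
  have hden : 0 < Real.log α - Real.log (1 + 2 * r) + r * (1 + r) / (6 * (1 + 2 * r)) := by
    have : 0 < r * (1 + r) / (6 * (1 + 2 * r)) := by positivity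
    linarith
  have hmid : ∫ t in (ti + 2 * (r * ti))..(α * ti), γ * β / t
      = γ * β * (Real.log α - Real.log (1 + 2 * r)) := by
    simp_rw [div_eq_mul_inv]
    rw [intervalIntegral.integral_const_mul, integral_inv_of_pos hpos hαt,
      show ti + 2 * (r * ti) = (1 + 2 * r) * ti by ring, mul_div_mul_right _ _ hti.ne',
      Real.log_div hα0.ne' hr2.ne']
  have hint : ∫ t in (ti + r * ti / 6)..(α * ti + r * (α * ti) / 6), φ t = γ * Real.log α := by
    have hβ' : β * (Real.log α - Real.log (1 + 2 * r) + r * (1 + r) / (6 * (1 + 2 * r)))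
        = Real.log α := by rw [hβ, div_mul_cancel₀ _ hden.ne']
    rw [← intervalIntegral.integral_add_adjacent_intervals ((i1.trans i2).trans i3) i4,
      ← intervalIntegral.integral_add_adjacent_intervals (i1.trans i2) i3,
      ← intervalIntegral.integral_add_adjacent_intervals i1 i2, e1, e2, e3, e4, hmid,
      integral_const_mul_sub_left, integral_const_mul_sub_right, intervalIntegral.integral_zero]
    refine Eq.trans ?_ (congrArg (γ * ·) hβ')
    field_simp
    ring
  refine ⟨hint, fun g hg hderiv hinit => ?_⟩
  have h := log_sub_log_eq_integral_of_hasDerivAt (by linarith)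
    (((i1.trans i2).trans i3).trans i4) hg hderiv
  have ha : 0 < ti + r * ti / 6 := by positivity
  have hb : α * ti + r * (α * ti) / 6 = α * (ti + r * ti / 6) := by ring
  rw [hint, hinit, Real.log_rpow ha] at h
  refine Real.log_injOn_pos (hg _) (Real.rpow_pos_of_pos (by linarith) _) ?_
  rw [Real.log_rpow (by linarith), show Real.log (α * ti + r * (α * ti) / 6)
    = Real.log α + Real.log (ti + r * ti / 6) by rw [hb, Real.log_mul hα0.ne' ha.ne']]
  linarith
end

section
/- Suppose 1/2 ≤ β ≤ 2. Then for every t ∈ [tᵢ + rᵢ/6, t_{i+1} + r_{i+1}/6] one has 0 ≤ φ(t) ≤ 2·(1 + r/6)·γ/t. -/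
open Real

/-- A ramp `c * x` with `x ≤ h` is bounded by `M / t` for `t ≤ b` as soon as its peak value
satisfies `c * h * b ≤ M`. -/
lemma mul_le_div_of_peak_le {c x h t b M : ℝ} (hc : 0 ≤ c) (hx : 0 ≤ x) (hxh : x ≤ h)
    (ht : 0 < t) (htb : t ≤ b) (hM : c * h * b ≤ M) : c * x ≤ M / t := by
  rw [le_div_iff₀ ht]
  have hh : 0 ≤ h := hx.trans hxh
  calc c * x * t ≤ c * h * b := by gcongr
    _ ≤ M := hM

theorem statement10 (r γ α β ti : ℝ) (φ : ℝ → ℝ)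
    (hr : 0 < r) (hγ : 0 < γ) (hα : α > 1 + 2 * r)
    (hβ : β = Real.log α /
      (Real.log α - Real.log (1 + 2 * r) + r * (1 + r) / (6 * (1 + 2 * r))))
    (hβ1 : 1 / 2 ≤ β) (hβ2 : β ≤ 2)
    (hti : 0 < ti)
    (hφ1 : ∀ t ∈ Set.Icc (ti + r * ti / 6) (ti + 11 * (r * ti) / 6), φ t = 0)
    (hφ2 : ∀ t ∈ Set.Icc (ti + 11 * (r * ti) / 6) (ti + 2 * (r * ti)),
      φ t = (6 * γ * β / ((1 + 2 * r) * r * ti ^ 2)) * (t - (ti + 11 * (r * ti) / 6)))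
    (hφ3 : ∀ t ∈ Set.Icc (ti + 2 * (r * ti)) (α * ti), φ t = γ * β / t)
    (hφ4 : ∀ t ∈ Set.Icc (α * ti) (α * ti + r * (α * ti) / 6),
      φ t = (6 * γ * β / (α ^ 2 * r * ti ^ 2)) * ((α * ti + r * (α * ti) / 6) - t)) :
    ∀ t ∈ Set.Icc (ti + r * ti / 6) (α * ti + r * (α * ti) / 6),
      0 ≤ φ t ∧ φ t ≤ 2 * (1 + r / 6) * γ / t := by
  rintro t ⟨ht1, ht2⟩
  have hrt : 0 < r * ti := mul_pos hr hti
  have ht : 0 < t := by linarith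
  have hα0 : 0 < α := by linarith
  have hβ0 : 0 < β := by linarith
  have hpeak : γ * β * (1 + r / 6) ≤ 2 * (1 + r / 6) * γ := by
    calc γ * β * (1 + r / 6) ≤ γ * 2 * (1 + r / 6) := by gcongr
      _ = 2 * (1 + r / 6) * γ := by ring
  have hplateau : γ * β ≤ 2 * (1 + r / 6) * γ :=
    (le_mul_of_one_le_right (by positivity) (by linarith)).trans hpeak
  rcases le_total t (ti + 11 * (r * ti) / 6) with h1 | h1
  · rw [hφ1 t ⟨ht1, h1⟩]
    exact ⟨le_rfl, by positivity⟩
  rcases le_total t (ti + 2 * (r * ti)) with h2 | h2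
  · rw [hφ2 t ⟨h1, h2⟩]
    refine ⟨mul_nonneg (by positivity) (by linarith), ?_⟩
    refine mul_le_div_of_peak_le (h := r * ti / 6) (b := (1 + 2 * r) * ti) (by positivity)
      (by linarith) (by linarith) ht (by linarith) (le_of_eq_of_le ?_ hplateau)
    field_simp
  rcases le_total t (α * ti) with h3 | h3
  · rw [hφ3 t ⟨h2, h3⟩]
    exact ⟨by positivity, by gcongr⟩
  · rw [hφ4 t ⟨h3, ht2⟩]
    refine ⟨mul_nonneg (by positivity) (by linarith), ?_⟩
    refine mul_le_div_of_peak_le (h := r * (α * ti) / 6) (b := α * ti * (1 + r / 6))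
      (by positivity) (by linarith) (by linarith) ht (by linarith) (le_of_eq_of_le ?_ hpeak)
    field_simp
end

section
/- Suppose 0 < γ < 1/4 and 1/2 ≤ β ≤ 2, and let g be a positive C¹ solution of g'(t)/g(t) = φ(t). Then: (i) at every point t of the interval (tᵢ, tᵢ + 2rᵢ) where φ is differentiable, |g''(t)/g(t)| = |φ'(t) + φ(t)²| ≤ 12γ·(1 + rγ/3)/(r·tᵢ²); and (ii) for every t ∈ (tᵢ + 2rᵢ, t_{i+1}), −g''(t)/g(t) = −(φ'(t) + φ(t)²) = γβ·(1 − γβ)/t² ≥ γ·(1 − 2γ)/(2t²). -/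
open Real

/-- If `g' = φ g` near `t`, then `g'' / g = φ' + φ ^ 2` at `t`. -/
theorem deriv_deriv_div_of_logDeriv_eventuallyEq {φ g : ℝ → ℝ} {t : ℝ} (hgt : ∀ s, g s ≠ 0)
    (hd : DifferentiableAt ℝ g t) (hg : ∀ᶠ s in nhds t, deriv g s / g s = φ s)
    (hφ : DifferentiableAt ℝ φ t) :
    deriv (deriv g) t / g t = deriv φ t + φ t ^ 2 := by
  have hmul : deriv g =ᶠ[nhds t] fun s => φ s * g s :=
    hg.mono fun s hs => (div_eq_iff (hgt s)).1 hs
  have hderiv : deriv (deriv g) t = deriv φ t * g t + φ t * deriv g t := by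
    rw [hmul.deriv_eq]
    exact (hφ.hasDerivAt.mul hd.hasDerivAt).deriv
  rw [div_eq_iff (hgt t), hderiv, hmul.eq_of_nhds]
  ring

/-- A function that is differentiable at `t` and affine on a set with unique derivatives at `t`
has the slope of the affine function as its derivative. -/
theorem deriv_eq_of_eqOn_affine {φ : ℝ → ℝ} {s : Set ℝ} {t c d : ℝ}
    (hs : UniqueDiffWithinAt ℝ s t) (ht : t ∈ s) (hφ : ∀ x ∈ s, φ x = c * (x - d))
    (hd : DifferentiableAt ℝ φ t) : deriv φ t = c := by
  have haff : HasDerivWithinAt φ c s t := by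
    have h := (((hasDerivAt_id t).sub_const d).const_mul c).hasDerivWithinAt (s := s)
    rw [mul_one] at h
    exact h.congr hφ (hφ t ht)
  exact hs.eq_deriv s hd.hasDerivAt.hasDerivWithinAt haff

/-- An affine piece of slope at most `12 γ / (r τ ^ 2)` evaluated within `r τ / 6` of its zero
satisfies the curvature bound. -/
theorem abs_slope_add_sq_le {r γ τ c u : ℝ} (hr : 0 < r) (hτ : 0 < τ)
    (hc : |c| ≤ 12 * γ / (r * τ ^ 2)) (hu : |u| ≤ r * τ / 6) :
    |c + (c * u) ^ 2| ≤ 12 * γ * (1 + r * γ / 3) / (r * τ ^ 2) := by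
  have hcu : |c * u| ≤ 2 * γ / τ := by
    rw [abs_mul]
    calc |c| * |u| ≤ 12 * γ / (r * τ ^ 2) * (r * τ / 6) :=
          mul_le_mul hc hu (abs_nonneg u) ((abs_nonneg c).trans hc)
      _ = 2 * γ / τ := by field_simp; ring
  calc |c + (c * u) ^ 2| ≤ |c| + |c * u| ^ 2 := by
        rw [← abs_pow]
        exact abs_add_le c ((c * u) ^ 2)
    _ ≤ 12 * γ / (r * τ ^ 2) + (2 * γ / τ) ^ 2 := by gcongr
    _ = 12 * γ * (1 + r * γ / 3) / (r * τ ^ 2) := by field_simp; ring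

theorem statement11 (r γ α β ti : ℝ) (φ g : ℝ → ℝ)
    (hr : 0 < r) (hγ0 : 0 < γ) (hγ1 : γ < 1 / 4) (hα : α > 1 + 2 * r)
    (hβ : β = Real.log α /
      (Real.log α - Real.log (1 + 2 * r) + r * (1 + r) / (6 * (1 + 2 * r))))
    (hβ1 : 1 / 2 ≤ β) (hβ2 : β ≤ 2)
    (hti : 0 < ti)
    (hφ0 : ∀ t ∈ Set.Ioc ti (ti + r * ti / 6),
      φ t = (6 * γ * β / (α ^ 2 * r * (ti / α) ^ 2)) * ((ti + r * ti / 6) - t))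
    (hφ1 : ∀ t ∈ Set.Icc (ti + r * ti / 6) (ti + 11 * (r * ti) / 6), φ t = 0)
    (hφ2 : ∀ t ∈ Set.Icc (ti + 11 * (r * ti) / 6) (ti + 2 * (r * ti)),
      φ t = (6 * γ * β / ((1 + 2 * r) * r * ti ^ 2)) * (t - (ti + 11 * (r * ti) / 6)))
    (hφ3 : ∀ t ∈ Set.Icc (ti + 2 * (r * ti)) (α * ti), φ t = γ * β / t)
    (hφ4 : ∀ t ∈ Set.Icc (α * ti) (α * ti + r * (α * ti) / 6),
      φ t = (6 * γ * β / (α ^ 2 * r * ti ^ 2)) * ((α * ti + r * (α * ti) / 6) - t))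
    (hgpos : ∀ t : ℝ, 0 < g t)
    (hg1 : ContDiff ℝ 1 g)
    (hg : ∀ t ∈ Set.Ioc ti (α * ti + r * (α * ti) / 6), deriv g t / g t = φ t) :
    (∀ t ∈ Set.Ioo ti (ti + 2 * (r * ti)),
      DifferentiableAt ℝ φ t →
        |deriv (deriv g) t / g t| = |deriv φ t + (φ t) ^ 2| ∧
        |deriv φ t + (φ t) ^ 2| ≤ 12 * γ * (1 + r * γ / 3) / (r * ti ^ 2)) ∧
    (∀ t ∈ Set.Ioo (ti + 2 * (r * ti)) (α * ti),
      -(deriv (deriv g) t) / g t = -(deriv φ t + (φ t) ^ 2) ∧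
      -(deriv φ t + (φ t) ^ 2) = γ * β * (1 - γ * β) / t ^ 2 ∧
      γ * (1 - 2 * γ) / (2 * t ^ 2) ≤ γ * β * (1 - γ * β) / t ^ 2) := by
  have hα0 : 0 < α := by linarith
  have hrt : 0 < r * ti := mul_pos hr hti
  have hend : ti + 2 * (r * ti) < α * ti := by nlinarith
  have hsecond : ∀ t ∈ Set.Ioo ti (α * ti), DifferentiableAt ℝ φ t →
      deriv (deriv g) t / g t = deriv φ t + φ t ^ 2 := by
    intro t ht hd
    refine deriv_deriv_div_of_logDeriv_eventuallyEq (fun s => (hgpos s).ne')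
      (hg1.differentiable one_ne_zero t) ?_ hd
    filter_upwards [Ioo_mem_nhds ht.1 ht.2] with s hs
    exact hg s ⟨hs.1, hs.2.le.trans (le_add_of_nonneg_right (by positivity))⟩
  have hpiece : ∀ (s : Set ℝ) (t c d : ℝ), UniqueDiffWithinAt ℝ s t → t ∈ s →
      (∀ x ∈ s, φ x = c * (x - d)) → DifferentiableAt ℝ φ t →
      |c| ≤ 12 * γ / (r * ti ^ 2) → |t - d| ≤ r * ti / 6 →
      |deriv φ t + φ t ^ 2| ≤ 12 * γ * (1 + r * γ / 3) / (r * ti ^ 2) := by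
    intro s t c d hs ht hφ hd hc hu
    rw [deriv_eq_of_eqOn_affine hs ht hφ hd, hφ t ht]
    exact abs_slope_add_sq_le hr hti hc hu
  have hβ0 : 0 < β := by linarith
  have hslope : 6 * γ * β / (r * ti ^ 2) ≤ 12 * γ / (r * ti ^ 2) := by
    refine div_le_div_of_nonneg_right ?_ (by positivity)
    nlinarith
  refine ⟨fun t ht hd => ⟨?_, ?_⟩, fun t ht => ?_⟩
  · rw [hsecond t ⟨ht.1, ht.2.trans hend⟩ hd]
  · obtain ⟨hlo, hhi⟩ := ht
    rcases le_total t (ti + r * ti / 6) with h | h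
    · refine hpiece _ t (-(6 * γ * β / (r * ti ^ 2))) (ti + r * ti / 6)
        (uniqueDiffOn_Ioc ti (ti + r * ti / 6) t ⟨hlo, h⟩) ⟨hlo, h⟩ ?_ hd ?_ ?_
      · intro x hx
        have hcoef : α ^ 2 * r * (ti / α) ^ 2 = r * ti ^ 2 := by field_simp
        rw [hφ0 x hx, hcoef]
        ring
      · rwa [abs_neg, abs_of_pos (by positivity)]
      · rw [abs_le]
        constructor <;> linarith
    rcases le_total t (ti + 11 * (r * ti) / 6) with h' | h'
    · refine hpiece _ t 0 t (uniqueDiffOn_Icc (by linarith) t ⟨h, h'⟩) ⟨h, h'⟩ ?_ hd ?_ ?_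
      · intro x hx
        rw [hφ1 x hx, zero_mul]
      · rw [abs_zero]
        positivity
      · rw [sub_self, abs_zero]
        positivity
    · refine hpiece _ t _ _ (uniqueDiffOn_Icc (by linarith) t ⟨h', hhi.le⟩) ⟨h', hhi.le⟩
        hφ2 hd ?_ ?_
      · rw [abs_of_pos (by positivity)]
        refine le_trans ?_ hslope
        rw [mul_assoc (1 + 2 * r)]
        exact div_le_div_of_nonneg_left (by positivity) (by positivity)
          (le_mul_of_one_le_left (by positivity) (by linarith))
      · rw [abs_le]
        constructor <;> linarith
  · obtain ⟨hlo, hhi⟩ := ht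
    have ht0 : 0 < t := by linarith
    have hφt : HasDerivAt φ (-(γ * β) / t ^ 2) t := by
      have h := (hasDerivAt_inv ht0.ne').const_mul (γ * β)
      have heq : φ =ᶠ[nhds t] fun s => γ * β * s⁻¹ := by
        filter_upwards [Ioo_mem_nhds hlo hhi] with s hs
        rw [hφ3 s ⟨hs.1.le, hs.2.le⟩, div_eq_mul_inv]
      exact (h.congr_of_eventuallyEq heq).congr_deriv (by ring)
    refine ⟨?_, ?_, ?_⟩
    · rw [neg_div, hsecond t ⟨by linarith, hhi⟩ hφt.differentiableAt]
    · rw [hφt.deriv, hφ3 t ⟨hlo.le, hhi.le⟩]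
      field_simp
      ring
    · rw [← div_div]
      gcongr
      have hγβ : γ * β ≤ 2 * γ := by nlinarith
      calc γ * (1 - 2 * γ) / 2 = γ * (1 / 2) * (1 - 2 * γ) := by ring
        _ ≤ γ * β * (1 - γ * β) := by
          gcongr
          linarith
end
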